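/- Let ξ ∈ S be pure. Then every nonzero element of the subspace {ρ(x)(ξ) : x ∈ V} of S (the image of the map x ↦ ρ(x)ξ) is itself a pure spinor. -/

import Mathlib

noncomputable section

open scoped TensorProduct

/-- The `(2m+1)`-dimensional space `V := N × N* × ℂ`. -/
abbrev Vsp (N : Type) [AddCommGroup N] [Module ℂ N] : Type := N × (N →ₗ[ℂ] ℂ) × ℂ

/-- The bilinear map `B((v,φ,t),(v',φ',t')) = φ(v') − t·t'`, whose diagonal is `Q`. -/
def Bform (N : Type) [AddCommGroup N] [Module ℂ N] : Vsp N →ₗ[ℂ] Vsp N →ₗ[ℂ] ℂ :=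
  LinearMap.mk₂ ℂ (fun x y => x.2.1 y.1 - x.2.2 * y.2.2)
    (fun x x' y => by simp only [Prod.fst_add, Prod.snd_add, LinearMap.add_apply]; ring)
    (fun c x y => by
      simp only [Prod.smul_fst, Prod.smul_snd, LinearMap.smul_apply, smul_eq_mul]; ring)
    (fun x y y' => by simp only [Prod.fst_add, Prod.snd_add, map_add]; ring)
    (fun c x y => by simp only [Prod.smul_fst, Prod.smul_snd, map_smul, smul_eq_mul]; ring)

/-- The quadratic form `Q(v, φ, t) := φ(v) − t²`. -/
def Qform (N : Type) [AddCommGroup N] [Module ℂ N] : QuadraticForm ℂ (Vsp N) :=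
  LinearMap.BilinMap.toQuadraticMap (Bform N)

/-- The polar form `g(x,y) := (Q(x+y) − Q(x) − Q(y))/2`. -/
def gform (N : Type) [AddCommGroup N] [Module ℂ N] (x y : Vsp N) : ℂ :=
  (Qform N (x + y) - Qform N x - Qform N y) / 2

/-- `σ` : the involution acting on `⋀^k N` as `(−1)^(m−k)`. -/
def sigmaMap (m : ℕ) (N : Type) [AddCommGroup N] [Module ℂ N] :
    ExteriorAlgebra ℂ N →ₗ[ℂ] ExteriorAlgebra ℂ N :=
  ((-1 : ℂ) ^ m) • (CliffordAlgebra.involute (Q := (0 : QuadraticForm ℂ N))).toLinearMap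

/-- `ρ(v, φ, t)(ξ) := v ∧ ξ − ι_φ(ξ) + t·σ(ξ)`. -/
def rho (m : ℕ) (N : Type) [AddCommGroup N] [Module ℂ N] :
    Vsp N →ₗ[ℂ] ExteriorAlgebra ℂ N →ₗ[ℂ] ExteriorAlgebra ℂ N :=
  (LinearMap.mul ℂ (ExteriorAlgebra ℂ N) ∘ₗ ExteriorAlgebra.ι ℂ ∘ₗ
      LinearMap.fst ℂ N ((N →ₗ[ℂ] ℂ) × ℂ))
  - (CliffordAlgebra.contractLeft (Q := (0 : QuadraticForm ℂ N)) ∘ₗ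
      LinearMap.fst ℂ (N →ₗ[ℂ] ℂ) ℂ ∘ₗ LinearMap.snd ℂ N ((N →ₗ[ℂ] ℂ) × ℂ))
  + (LinearMap.toSpanSingleton ℂ (ExteriorAlgebra ℂ N →ₗ[ℂ] ExteriorAlgebra ℂ N)
        (sigmaMap m N) ∘ₗ
      LinearMap.snd ℂ (N →ₗ[ℂ] ℂ) ℂ ∘ₗ LinearMap.snd ℂ N ((N →ₗ[ℂ] ℂ) × ℂ))

/-- `K_ξ := {x ∈ V : ρ(x)(ξ) = 0}`. -/
def Kker (m : ℕ) (N : Type) [AddCommGroup N] [Module ℂ N] (ξ : ExteriorAlgebra ℂ N) :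
    Submodule ℂ (Vsp N) :=
  LinearMap.ker ((rho m N).flip ξ)

section SpinorModule

variable {N : Type} [AddCommGroup N] [Module ℂ N]

open CliffordAlgebra in
/-- The grade involution anticommutes with contraction. -/
theorem CliffordAlgebra.involute_contractLeft {R M : Type*} [CommRing R] [AddCommGroup M]
    [Module R M] {Q : QuadraticForm R M} (d : Module.Dual R M) (a : CliffordAlgebra Q) :
    involute (contractLeft d a) = -contractLeft d (involute a) := by
  induction a using CliffordAlgebra.left_induction with
  | algebraMap r => simp [contractLeft_algebraMap]
  | add a b ha hb => simp only [map_add, ha, hb, neg_add]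
  | ι_mul a v ha =>
    simp only [contractLeft_ι_mul, map_sub, map_mul, map_smul, involute_ι, ha, neg_mul, map_neg,
      mul_neg, neg_neg]

/-- Twice the polar form of `Qform`, as a bilinear form. -/
def polarBilin (N : Type) [AddCommGroup N] [Module ℂ N] : LinearMap.BilinForm ℂ (Vsp N) :=
  Bform N + (Bform N).flip

theorem polarBilin_apply (x y : Vsp N) :
    polarBilin N x y = x.2.1 y.1 + y.2.1 x.1 - 2 * (x.2.2 * y.2.2) := by
  simp only [polarBilin, Bform, LinearMap.add_apply, LinearMap.flip_apply, LinearMap.mk₂_apply]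
  ring

theorem polarBilin_comm (x y : Vsp N) : polarBilin N x y = polarBilin N y x := by
  rw [polarBilin_apply, polarBilin_apply]
  ring

theorem ker_polarBilin : LinearMap.ker (polarBilin N) = ⊥ := by
  rw [LinearMap.ker_eq_bot']
  rintro ⟨v, φ, t⟩ h
  have hval : ∀ y : Vsp N, φ y.1 + y.2.1 v - 2 * (t * y.2.2) = 0 := fun y => by
    rw [← polarBilin_apply (v, φ, t) y, h, LinearMap.zero_apply]
  have hv : v = 0 := (Module.forall_dual_apply_eq_zero_iff ℂ v).1 fun ψ => by
    simpa using hval (0, ψ, 0)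
  have hφ : φ = 0 := LinearMap.ext fun w => by simpa using hval (w, 0, 0)
  have ht : t = 0 := by simpa using hval (0, 0, 1)
  simp [hv, hφ, ht]

theorem finrank_Vsp [FiniteDimensional ℂ N] :
    Module.finrank ℂ (Vsp N) = 2 * Module.finrank ℂ N + 1 := by
  have hdual : Module.finrank ℂ (N →ₗ[ℂ] ℂ) = Module.finrank ℂ N := Subspace.dual_finrank_eq
  rw [Module.finrank_prod, Module.finrank_prod, hdual, Module.finrank_self]
  ring

/-- A totally isotropic subspace of `V` has dimension at most `dim N`. -/
theorem finrank_le_of_isotropic [FiniteDimensional ℂ N] (W : Submodule ℂ (Vsp N))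
    (hW : ∀ x ∈ W, ∀ y ∈ W, polarBilin N x y = 0) :
    Module.finrank ℂ W ≤ Module.finrank ℂ N := by
  have horth := LinearMap.BilinForm.finrank_add_finrank_orthogonal' (B := polarBilin N) W
  rw [ker_polarBilin, inf_bot_eq, finrank_bot, finrank_Vsp] at horth
  have hle : W ≤ (polarBilin N).orthogonal W := fun x hx y hy => hW y hy x hx
  have := Submodule.finrank_mono hle
  omega

theorem rho_apply (m : ℕ) (x : Vsp N) (ξ : ExteriorAlgebra ℂ N) :
    rho m N x ξ = ExteriorAlgebra.ι ℂ x.1 * ξ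
      - CliffordAlgebra.contractLeft (Q := (0 : QuadraticForm ℂ N)) x.2.1 ξ
      + x.2.2 • ((-1 : ℂ) ^ m • CliffordAlgebra.involute (Q := (0 : QuadraticForm ℂ N)) ξ) :=
  rfl

theorem mem_Kker {m : ℕ} {ξ : ExteriorAlgebra ℂ N} {x : Vsp N} :
    x ∈ Kker m N ξ ↔ rho m N x ξ = 0 :=
  Iff.rfl

open CliffordAlgebra in
/-- The Clifford relation `ρ(x)² = -Q(x)`. -/
theorem rho_rho_self (m : ℕ) (x : Vsp N) (ξ : ExteriorAlgebra ℂ N) :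
    rho m N x (rho m N x ξ) = -(x.2.1 x.1 - x.2.2 * x.2.2) • ξ := by
  obtain ⟨v, φ, t⟩ := x
  have hsq : ExteriorAlgebra.ι ℂ v * (ExteriorAlgebra.ι ℂ v * ξ) = 0 := by
    rw [← mul_assoc, ExteriorAlgebra.ι_sq_zero, zero_mul]
  have hcon : contractLeft (Q := (0 : QuadraticForm ℂ N)) φ (ExteriorAlgebra.ι ℂ v * ξ)
      = φ v • ξ - ExteriorAlgebra.ι ℂ v * contractLeft (Q := (0 : QuadraticForm ℂ N)) φ ξ :=
    contractLeft_ι_mul φ v ξ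
  have hinv : involute (Q := (0 : QuadraticForm ℂ N)) (ExteriorAlgebra.ι ℂ v) =
      -ExteriorAlgebra.ι ℂ v := involute_ι v
  have hsign : ((-1 : ℂ) ^ m) * (-1) ^ m = 1 := by rw [← mul_pow]; simp
  have hsymm : involute (Q := (0 : QuadraticForm ℂ N)) (involute ξ) = ξ := involute_involute ξ
  simp only [rho_apply, map_add, map_sub, map_smul, map_mul, hsq, hcon, hinv,
    contractLeft_contractLeft, CliffordAlgebra.involute_contractLeft, hsymm, neg_mul,
    smul_add, smul_sub, smul_neg]
  have hcoef : t • (-1 : ℂ) ^ m • t • (-1 : ℂ) ^ m • ξ = (t * t) • ξ := by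
    simp only [smul_smul]
    congr 1
    linear_combination t * t * hsign
  rw [hcoef, neg_smul, sub_smul]
  abel

/-- The polarized Clifford relation `ρ(x)ρ(y) + ρ(y)ρ(x) = -2g(x, y)`. -/
theorem rho_rho_add_swap (m : ℕ) (x y : Vsp N) (ξ : ExteriorAlgebra ℂ N) :
    rho m N x (rho m N y ξ) + rho m N y (rho m N x ξ) = -polarBilin N x y • ξ := by
  have h := rho_rho_self m (x + y) ξ
  simp only [map_add, LinearMap.add_apply, rho_rho_self, Prod.fst_add, Prod.snd_add] at h
  rw [polarBilin_apply]
  linear_combination (norm := module) h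

theorem polarBilin_eq_zero_of_mem_Kker {m : ℕ} {ξ : ExteriorAlgebra ℂ N} (hξ : ξ ≠ 0)
    {x y : Vsp N} (hx : x ∈ Kker m N ξ) (hy : y ∈ Kker m N ξ) : polarBilin N x y = 0 := by
  have h := rho_rho_add_swap m x y ξ
  rw [mem_Kker.1 hx, mem_Kker.1 hy, map_zero, map_zero, add_zero] at h
  simpa [hξ] using h.symm

theorem mem_Kker_rho_of_polarBilin_eq_zero {m : ℕ} {ξ : ExteriorAlgebra ℂ N} {x y : Vsp N}
    (hy : y ∈ Kker m N ξ) (hxy : polarBilin N x y = 0) : y ∈ Kker m N (rho m N x ξ) := by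
  have h := rho_rho_add_swap m x y ξ
  rw [mem_Kker.1 hy, map_zero, zero_add, hxy, neg_zero, zero_smul] at h
  exact h

/-- Acting on a spinor by an isotropic vector outside its annihilator does not shrink the
annihilator. -/
theorem finrank_Kker_le_of_isotropic [FiniteDimensional ℂ N] {m : ℕ} {ξ : ExteriorAlgebra ℂ N}
    {x : Vsp N} (hx : polarBilin N x x = 0) (hxξ : x ∉ Kker m N ξ) :
    Module.finrank ℂ (Kker m N ξ) ≤ Module.finrank ℂ (Kker m N (rho m N x ξ)) := by
  have hx0 : polarBilin N x ≠ 0 := fun h => hxξ <| by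
    rw [LinearMap.ker_eq_bot'.1 ker_polarBilin x h]
    exact zero_mem _
  have hker := Module.Dual.finrank_ker_add_one_of_ne_zero hx0
  have hdim := Submodule.finrank_sup_add_finrank_inf_eq (Kker m N ξ)
    (LinearMap.ker (polarBilin N x))
  have hsup := (Kker m N ξ ⊔ LinearMap.ker (polarBilin N x)).finrank_le
  have hxη : x ∈ Kker m N (rho m N x ξ) := by
    have hQ : x.2.1 x.1 - x.2.2 * x.2.2 = 0 := by
      rw [polarBilin_apply] at hx
      linear_combination hx / 2
    rw [mem_Kker, rho_rho_self, hQ, neg_zero, zero_smul]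
  have hlt : Kker m N ξ ⊓ LinearMap.ker (polarBilin N x) < Kker m N (rho m N x ξ) :=
    lt_of_le_of_ne (fun y hy => mem_Kker_rho_of_polarBilin_eq_zero hy.1 hy.2)
      fun h => hxξ (h.symm ▸ hxη : x ∈ Kker m N ξ ⊓ LinearMap.ker (polarBilin N x)).1
  have := Submodule.finrank_lt_finrank_of_lt hlt
  omega

theorem finrank_Kker_le_finrank_Kker_rho [FiniteDimensional ℂ N] {m : ℕ}
    {ξ : ExteriorAlgebra ℂ N} (hξ : ξ ≠ 0) {x : Vsp N} (hx : rho m N x ξ ≠ 0) :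
    Module.finrank ℂ (Kker m N ξ) ≤ Module.finrank ℂ (Kker m N (rho m N x ξ)) := by
  by_cases horth : ∀ k ∈ Kker m N ξ, polarBilin N x k = 0
  · exact Submodule.finrank_mono fun k hk => mem_Kker_rho_of_polarBilin_eq_zero hk (horth k hk)
  -- Otherwise `x` can be made isotropic by adding an element of the annihilator of `ξ`.
  push Not at horth
  obtain ⟨k, hk, hxk⟩ := horth
  let c : ℂ := -polarBilin N x x / (2 * polarBilin N x k)
  have hrho : rho m N (x + c • k) ξ = rho m N x ξ := by
    rw [map_add, map_smul, LinearMap.add_apply, LinearMap.smul_apply, mem_Kker.1 hk, smul_zero,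
      add_zero]
  have hiso : polarBilin N (x + c • k) (x + c • k) = 0 := by
    simp only [map_add, map_smul, LinearMap.add_apply, LinearMap.smul_apply, smul_eq_mul,
      polarBilin_eq_zero_of_mem_Kker hξ hk hk, polarBilin_comm k x, c]
    field_simp
    ring
  rw [← hrho]
  exact finrank_Kker_le_of_isotropic hiso fun h => hx (hrho ▸ mem_Kker.1 h)

end SpinorModule

/-- every nonzero element of the image `{ρ(x)ξ : x ∈ V}` of a pure
spinor `ξ` is itself pure. -/
theorem image_spinors_are_pure
    (m : ℕ) (hm : 0 < m) (N : Type) [AddCommGroup N] [Module ℂ N]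
    [FiniteDimensional ℂ N] (hdim : Module.finrank ℂ N = m)
    (ξ : ExteriorAlgebra ℂ N) (hξ0 : ξ ≠ 0)
    (hξ : Module.finrank ℂ (Kker m N ξ) = m) :
    ∀ η ∈ LinearMap.range ((rho m N).flip ξ), η ≠ 0 →
      Module.finrank ℂ (Kker m N η) = m := by
  rintro η ⟨x, hx⟩ hη
  replace hx : rho m N x ξ = η := hx
  refine le_antisymm ?_ ?_
  · refine (finrank_le_of_isotropic (Kker m N η) fun y hy z hz => ?_).trans hdim.le
    exact polarBilin_eq_zero_of_mem_Kker hη hy hz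
  · have hle := finrank_Kker_le_finrank_Kker_rho hξ0 (ne_of_eq_of_ne hx hη)
    rwa [hx, hξ] at hle
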